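/- Let α>0 and γ(n)→+∞. Suppose (Xⁿ) satisfies hypothesis (G) at speed γ(n) with limit kernel k̄. Let (Yⁿ)=(Y₁ⁿ,Y₂ⁿ) be random variables with values in C_α×C, independent of (Xⁿ), satisfying an LDP on C_α×C with good rate function I_Y and speed γ(n), and set Zⁿ(t)=Y₁ⁿ(t)Xⁿ(t)+Y₂ⁿ(t). Then the family (Yⁿ,Zⁿ) satisfies a weak LDP on (C_α×C)×C with speed γ(n) and rate function I((y₁,y₂),z)=I_Y(y₁,y₂)+Λ*_{k̄}((z−y₂)/y₁), and (Zⁿ) satisfies an LDP on C with speed γ(n) and rate function I_Z(z)=inf over (y₁,y₂)∈C_α×C of { I_Y(y₁,y₂)+Λ*_{k̄}((z−y₂)/y₁) }. -/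

import Mathlib

open MeasureTheory ProbabilityTheory Filter Topology
open scoped ENNReal NNReal

noncomputable section

/-- The unit interval `[0,1]` as a subtype of `ℝ`. -/
abbrev UI : Type := Set.Icc (0:ℝ) 1

/-- `C([0,1],ℝ)`, the continuous real functions on `[0,1]` with the sup-norm. -/
abbrev CC : Type := C(UI, ℝ)

instance : MeasurableSpace CC := borel CC
instance : BorelSpace CC := ⟨rfl⟩

/-- Pairing `⟨λ,h⟩ = ∫₀¹ h dλ` of a finite signed Borel measure on `[0,1]`
with a function `h`. -/
def pairSM (lam : MeasureTheory.SignedMeasure UI) (h : UI → ℝ) : ℝ :=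
  (∫ t, h t ∂lam.toJordanDecomposition.posPart) -
    (∫ t, h t ∂lam.toJordanDecomposition.negPart)

/-- Double integral `∫₀¹∫₀¹ k(t,s) dλ(t) dλ(s)`. -/
def dblInt (lam : MeasureTheory.SignedMeasure UI) (k : UI → UI → ℝ) : ℝ :=
  pairSM lam (fun t => pairSM lam (fun s => k t s))

/-- `Λ_k(λ) = (1/2)∫₀¹∫₀¹ k(t,s) dλ(t)dλ(s)`. -/
def LamK (k : UI → UI → ℝ) (lam : MeasureTheory.SignedMeasure UI) : ℝ :=
  (1/2) * dblInt lam k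

/-- The Cramér transform `Λ*_k(h) = sup_λ (⟨λ,h⟩ − Λ_k(λ)) ∈ [0,∞]`. -/
def CramerK (k : UI → UI → ℝ) (h : UI → ℝ) : ℝ≥0∞ :=
  ⨆ lam : MeasureTheory.SignedMeasure UI, ENNReal.ofReal (pairSM lam h - LamK k lam)

/-- A continuous, symmetric, positive semidefinite kernel on `[0,1]²`. -/
def IsPSDKernel (k : UI → UI → ℝ) : Prop :=
  Continuous (fun p : UI × UI => k p.1 p.2) ∧ (∀ s t, k s t = k t s) ∧
    ∀ (n : ℕ) (t : Fin n → UI) (c : Fin n → ℝ),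
      0 ≤ ∑ i, ∑ j, c i * c j * k (t i) (t j)

/-- Extended logarithm of an extended nonnegative real. -/
def elog (x : ℝ≥0∞) : EReal :=
  if x = 0 then ⊥ else if x = ⊤ then ⊤ else ((Real.log x.toReal : ℝ) : EReal)

/-- Large-deviation lower bound for open sets. -/
def LDPLower {E : Type*} [TopologicalSpace E] [MeasurableSpace E]
    (μ : ℕ → Measure E) (γ : ℕ → ℝ) (I : E → ℝ≥0∞) : Prop :=
  ∀ Θ : Set E, IsOpen Θ →
    -(⨅ x ∈ Θ, (I x : EReal)) ≤
      Filter.atTop.liminf fun n => (((γ n)⁻¹ : ℝ) : EReal) * elog (μ n Θ)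

/-- Large-deviation upper bound for closed sets. -/
def LDPUpper {E : Type*} [TopologicalSpace E] [MeasurableSpace E]
    (μ : ℕ → Measure E) (γ : ℕ → ℝ) (I : E → ℝ≥0∞) : Prop :=
  ∀ Γ : Set E, IsClosed Γ →
    (Filter.atTop.limsup fun n => (((γ n)⁻¹ : ℝ) : EReal) * elog (μ n Γ)) ≤
      -(⨅ x ∈ Γ, (I x : EReal))

/-- Large-deviation upper bound for compact sets. -/
def LDPUpperCompact {E : Type*} [TopologicalSpace E] [MeasurableSpace E]
    (μ : ℕ → Measure E) (γ : ℕ → ℝ) (I : E → ℝ≥0∞) : Prop :=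
  ∀ Γ : Set E, IsCompact Γ →
    (Filter.atTop.limsup fun n => (((γ n)⁻¹ : ℝ) : EReal) * elog (μ n Γ)) ≤
      -(⨅ x ∈ Γ, (I x : EReal))

/-- `(μₙ)` satisfies a large deviation principle with speed `γ` and
(lower semicontinuous) rate function `I`. -/
def LDP {E : Type*} [TopologicalSpace E] [MeasurableSpace E]
    (μ : ℕ → Measure E) (γ : ℕ → ℝ) (I : E → ℝ≥0∞) : Prop :=
  LowerSemicontinuous I ∧ LDPLower μ γ I ∧ LDPUpper μ γ I

/-- `(μₙ)` satisfies a weak large deviation principle with speed `γ` and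
rate function `I` (upper bound only for compact sets). -/
def WLDP {E : Type*} [TopologicalSpace E] [MeasurableSpace E]
    (μ : ℕ → Measure E) (γ : ℕ → ℝ) (I : E → ℝ≥0∞) : Prop :=
  LowerSemicontinuous I ∧ LDPLower μ γ I ∧ LDPUpperCompact μ γ I

/-- A good rate function: lower semicontinuous with compact sublevel sets. -/
def GoodRate {E : Type*} [TopologicalSpace E] (I : E → ℝ≥0∞) : Prop :=
  LowerSemicontinuous I ∧ ∀ a : ℝ≥0, IsCompact {x | I x ≤ (a : ℝ≥0∞)}

/-- A family of random variables satisfies an LDP if the family of their laws does. -/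
def LDPrv {Ω E : Type*} [MeasurableSpace Ω] [TopologicalSpace E] [MeasurableSpace E]
    (P : Measure Ω) (X : ℕ → Ω → E) (γ : ℕ → ℝ) (I : E → ℝ≥0∞) : Prop :=
  LDP (fun n => P.map (X n)) γ I

/-- A family of random variables satisfies a WLDP if the family of their laws does. -/
def WLDPrv {Ω E : Type*} [MeasurableSpace Ω] [TopologicalSpace E] [MeasurableSpace E]
    (P : Measure Ω) (X : ℕ → Ω → E) (γ : ℕ → ℝ) (I : E → ℝ≥0∞) : Prop :=
  WLDP (fun n => P.map (X n)) γ I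

/-- Exponential tightness at speed `γ(n)` of a family of `C([0,1],ℝ)`-valued
random variables. -/
def ExpTight {Ω : Type*} [MeasurableSpace Ω] (P : Measure Ω) (X : ℕ → Ω → CC)
    (γ : ℕ → ℝ) : Prop :=
  ∀ R : ℝ, 0 < R → ∃ K : Set CC, IsCompact K ∧
    (Filter.atTop.limsup fun n => (((γ n)⁻¹ : ℝ) : EReal) * elog (P (X n ⁻¹' Kᶜ))) ≤
      ((-R : ℝ) : EReal)

/-- A real random variable is Gaussian. -/
def IsGaussianRV {Ω : Type*} [MeasurableSpace Ω] (P : Measure Ω) (ξ : Ω → ℝ) : Prop :=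
  ∃ (m : ℝ) (v : ℝ≥0), P.map ξ = gaussianReal m v

/-- A `C([0,1],ℝ)`-valued random variable is a continuous Gaussian process:
`⟨λ,X⟩` is a Gaussian real random variable for every signed measure `λ`. -/
def IsContGaussian {Ω : Type*} [MeasurableSpace Ω] (P : Measure Ω) (X : Ω → CC) : Prop :=
  Measurable X ∧ ∀ lam : MeasureTheory.SignedMeasure UI,
    IsGaussianRV P fun ω => pairSM lam (X ω)

/-- A continuous Gaussian process is centered: `E⟨λ,X⟩ = 0` for all `λ`. -/
def IsCentered {Ω : Type*} [MeasurableSpace Ω] (P : Measure Ω) (X : Ω → CC) : Prop :=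
  ∀ lam : MeasureTheory.SignedMeasure UI, ∫ ω, pairSM lam (X ω) ∂P = 0

/-- `k` is the covariance function of some centered continuous Gaussian process. -/
def IsCovOfCenteredCGP (k : UI → UI → ℝ) : Prop :=
  ∃ (Ω' : Type) (_ : MeasurableSpace Ω') (P' : Measure Ω') (U : Ω' → CC),
    IsProbabilityMeasure P' ∧ IsContGaussian P' U ∧ IsCentered P' U ∧
      ∀ s t : UI, k s t = ∫ ω, U ω s * U ω t ∂P'

/-- Hypothesis (G): `(Xⁿ)` are centered continuous Gaussian processes,
exponentially tight at speed `γ(n)`, with `γ(n)·Var⟨λ,Xⁿ⟩ → ∫∫ k̄ dλdλ`,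
where `k̄` is a continuous symmetric positive semidefinite kernel which is the
covariance of some centered continuous Gaussian process. -/
def HypG {Ω : Type*} [MeasurableSpace Ω] (P : Measure Ω) (X : ℕ → Ω → CC)
    (γ : ℕ → ℝ) (kbar : UI → UI → ℝ) : Prop :=
  (∀ n, IsContGaussian P (X n)) ∧ (∀ n, IsCentered P (X n)) ∧
    ExpTight P X γ ∧ IsPSDKernel kbar ∧ IsCovOfCenteredCGP kbar ∧
    ∀ lam : MeasureTheory.SignedMeasure UI,
      Tendsto (fun n => γ n * variance (fun ω => pairSM lam (X n ω)) P) atTop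
        (nhds (dblInt lam kbar))

/-- `C_α = {y ∈ C([0,1],ℝ) : y(t) ≥ α for all t}`. -/
def Calpha (α : ℝ) : Set CC := {y : CC | ∀ t, α ≤ y t}

/-- The mean function `m(t) = e^{a₁t}(x + (a₀/a₁)(1−e^{−a₁t}))` of the
Ornstein–Uhlenbeck process. -/
def mFun (a0 a1 x : ℝ) (t : UI) : ℝ :=
  Real.exp (a1 * t) * (x + a0 / a1 * (1 - Real.exp (-(a1 * t))))

/-- The covariance kernel `kʸ(s,t) = e^{a₁(s+t)} ∫₀^{s∧t} e^{−2a₁u} y(u)² du`. -/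
def kyFun (a1 : ℝ) (y : CC) (s t : UI) : ℝ :=
  Real.exp (a1 * ((s : ℝ) + (t : ℝ))) *
    ∫ u in (0:ℝ)..(min (s : ℝ) (t : ℝ)),
      Real.exp (-(2 * a1 * u)) * (Set.IccExtend zero_le_one (⇑y) u) ^ 2

/-- The Freidlin–Wentzell rate function
`J(f|y) = (1/2)∫₀¹ ((φ(t) − a₀ − a₁f(t))/y(t))² dt` if `f = x + ∫₀^· φ` for some
`φ ∈ L²[0,1]`, and `+∞` otherwise. -/
def Jfw (a0 a1 x : ℝ) (y f : CC) : ℝ≥0∞ :=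
  ⨅ (φ : ℝ → ℝ) (_ : MemLp φ 2 (volume.restrict (Set.Icc (0:ℝ) 1)))
      (_ : ∀ t : UI, f t = x + ∫ s in (0:ℝ)..(t : ℝ), φ s),
    ENNReal.ofReal ((1/2) * ∫ t in (0:ℝ)..1,
      ((φ t - a0 - a1 * Set.IccExtend zero_le_one (⇑f) t) /
        Set.IccExtend zero_le_one (⇑y) t) ^ 2)


/-- Exponential upper bound at rate `b`. -/
def UBd (γ : ℕ → ℝ) (f : ℕ → ℝ≥0∞) (b : ℝ) : Prop :=
  ∀ᶠ n in atTop, f n ≤ ENNReal.ofReal (Real.exp (-(γ n * b)))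

/-- Exponential lower bound at rate `b`. -/
def LBd (γ : ℕ → ℝ) (f : ℕ → ℝ≥0∞) (b : ℝ) : Prop :=
  ∀ᶠ n in atTop, ENNReal.ofReal (Real.exp (-(γ n * b))) ≤ f n

lemma elog_mul_le_iff (g r : ℝ) (hg : 0 < g) (x : ℝ≥0∞) :
    ((g⁻¹ : ℝ) : EReal) * elog x ≤ (r : EReal) ↔ x ≤ ENNReal.ofReal (Real.exp (g * r)) := by
  unfold elog
  split_ifs with h0 h1
  · subst h0
    simp [EReal.coe_mul_bot_of_pos (inv_pos.2 hg)]
  · subst h1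
    simp [EReal.coe_mul_top_of_pos (inv_pos.2 hg)]
  · have hx : 0 < x.toReal := ENNReal.toReal_pos h0 h1
    rw [← EReal.coe_mul, EReal.coe_le_coe_iff, inv_mul_le_iff₀ hg, Real.log_le_iff_le_exp hx,
      ENNReal.le_ofReal_iff_toReal_le h1 (Real.exp_pos _).le]

lemma le_elog_mul_iff (g r : ℝ) (hg : 0 < g) (x : ℝ≥0∞) :
    (r : EReal) ≤ ((g⁻¹ : ℝ) : EReal) * elog x ↔ ENNReal.ofReal (Real.exp (g * r)) ≤ x := by
  unfold elog
  split_ifs with h0 h1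
  · subst h0
    simp [EReal.coe_mul_bot_of_pos (inv_pos.2 hg), Real.exp_pos]
  · subst h1
    simp [EReal.coe_mul_top_of_pos (inv_pos.2 hg)]
  · have hx : 0 < x.toReal := ENNReal.toReal_pos h0 h1
    rw [← EReal.coe_mul, EReal.coe_le_coe_iff, le_inv_mul_iff₀ hg, Real.le_log_iff_exp_le hx,
      ENNReal.ofReal_le_iff_le_toReal h1]

lemma limsup_le_of_UBd {γ : ℕ → ℝ} (hγ : Tendsto γ atTop atTop) (f : ℕ → ℝ≥0∞) (c : EReal)
    (h : ∀ b : ℝ, (b : EReal) < c → UBd γ f b) :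
    (atTop.limsup fun n => (((γ n)⁻¹ : ℝ) : EReal) * elog (f n)) ≤ -c := by
  refine EReal.le_of_forall_lt_iff_le.1 ?_
  intro z hz
  have h1 : ((-z : ℝ) : EReal) < c := by
    rw [EReal.coe_neg]; exact EReal.neg_lt_comm.1 hz
  refine limsup_le_of_le (by isBoundedDefault) ?_
  filter_upwards [h _ h1, hγ.eventually_gt_atTop 0] with n hn hg
  rw [elog_mul_le_iff _ _ hg]
  simpa using hn

lemma UBd_of_limsup_le {γ : ℕ → ℝ} (hγ : Tendsto γ atTop atTop) (f : ℕ → ℝ≥0∞) (c : EReal)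
    (h : (atTop.limsup fun n => (((γ n)⁻¹ : ℝ) : EReal) * elog (f n)) ≤ -c)
    (b : ℝ) (hb : (b : EReal) < c) : UBd γ f b := by
  have h1 : -c < ((-b : ℝ) : EReal) := by
    rw [EReal.coe_neg]; exact EReal.neg_lt_neg_iff.2 hb
  filter_upwards [eventually_lt_of_limsup_lt (h.trans_lt h1), hγ.eventually_gt_atTop 0] with n hn hg
  have := (elog_mul_le_iff _ _ hg _).1 hn.le
  simpa using this

lemma le_liminf_of_LBd {γ : ℕ → ℝ} (hγ : Tendsto γ atTop atTop) (f : ℕ → ℝ≥0∞) (c : EReal)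
    (h : ∀ b : ℝ, c < (b : EReal) → LBd γ f b) :
    -c ≤ (atTop.liminf fun n => (((γ n)⁻¹ : ℝ) : EReal) * elog (f n)) := by
  refine EReal.ge_of_forall_gt_iff_ge.1 ?_
  intro z hz
  have h1 : c < ((-z : ℝ) : EReal) := by
    rw [EReal.coe_neg]; exact EReal.lt_neg_comm.1 hz
  refine le_liminf_of_le (by isBoundedDefault) ?_
  filter_upwards [h _ h1, hγ.eventually_gt_atTop 0] with n hn hg
  rw [le_elog_mul_iff _ _ hg]
  simpa using hn

lemma LBd_of_le_liminf {γ : ℕ → ℝ} (hγ : Tendsto γ atTop atTop) (f : ℕ → ℝ≥0∞) (c : EReal)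
    (h : -c ≤ (atTop.liminf fun n => (((γ n)⁻¹ : ℝ) : EReal) * elog (f n)))
    (b : ℝ) (hb : c < (b : EReal)) : LBd γ f b := by
  have h1 : ((-b : ℝ) : EReal) < -c := by
    rw [EReal.coe_neg]; exact EReal.neg_lt_neg_iff.2 hb
  filter_upwards [eventually_lt_of_lt_liminf (h1.trans_le h), hγ.eventually_gt_atTop 0] with n hn hg
  have := (le_elog_mul_iff _ _ hg _).1 hn.le
  simpa using this

lemma UBd.mono {γ : ℕ → ℝ} {f g : ℕ → ℝ≥0∞} {b : ℝ} (h : UBd γ f b) (hgf : ∀ n, g n ≤ f n) :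
    UBd γ g b := by
  filter_upwards [h] with n hn using (hgf n).trans hn

lemma LBd.mono {γ : ℕ → ℝ} {f g : ℕ → ℝ≥0∞} {b : ℝ} (h : LBd γ f b) (hgf : ∀ n, f n ≤ g n) :
    LBd γ g b := by
  filter_upwards [h] with n hn using hn.trans (hgf n)

lemma UBd.rate {γ : ℕ → ℝ} (hγ : Tendsto γ atTop atTop) {f : ℕ → ℝ≥0∞} {b b' : ℝ}
    (h : UBd γ f b) (hb : b' ≤ b) : UBd γ f b' := by
  filter_upwards [h, hγ.eventually_gt_atTop 0] with n hn hg
  refine hn.trans (ENNReal.ofReal_le_ofReal (Real.exp_le_exp.2 ?_))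
  nlinarith

lemma UBd.mul {γ : ℕ → ℝ} {f g : ℕ → ℝ≥0∞} {b b' : ℝ}
    (h : UBd γ f b) (h' : UBd γ g b') : UBd γ (fun n => f n * g n) (b + b') := by
  filter_upwards [h, h'] with n hn hn'
  refine (mul_le_mul' hn hn').trans ?_
  rw [← ENNReal.ofReal_mul (Real.exp_pos _).le, ← Real.exp_add]
  apply le_of_eq; congr 2; ring

lemma LBd.mul {γ : ℕ → ℝ} {f g : ℕ → ℝ≥0∞} {b b' : ℝ}
    (h : LBd γ f b) (h' : LBd γ g b') : LBd γ (fun n => f n * g n) (b + b') := by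
  filter_upwards [h, h'] with n hn hn'
  refine le_trans ?_ (mul_le_mul' hn hn')
  rw [← ENNReal.ofReal_mul (Real.exp_pos _).le, ← Real.exp_add]
  apply le_of_eq; congr 2; ring

lemma UBd.add {γ : ℕ → ℝ} (hγ : Tendsto γ atTop atTop) {f g : ℕ → ℝ≥0∞} {b b' : ℝ}
    (h : UBd γ f b) (h' : UBd γ g b) (hb : b' < b) : UBd γ (fun n => f n + g n) b' := by
  filter_upwards [h, h', hγ.eventually_ge_atTop (Real.log 2 / (b - b'))] with n hn hn' hg
  refine (add_le_add hn hn').trans ?_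
  rw [← ENNReal.ofReal_add (Real.exp_pos _).le (Real.exp_pos _).le]
  apply ENNReal.ofReal_le_ofReal
  rw [div_le_iff₀ (by linarith)] at hg
  calc _ = Real.exp (Real.log 2) * Real.exp (-(γ n * b)) := by
        rw [Real.exp_log (by norm_num)]; ring
    _ = Real.exp (Real.log 2 + -(γ n * b)) := by rw [Real.exp_add]
    _ ≤ _ := Real.exp_le_exp.2 (by linarith)

lemma UBd.tendsto_zero {γ : ℕ → ℝ} (hγ : Tendsto γ atTop atTop) {f : ℕ → ℝ≥0∞} {b : ℝ}
    (h : UBd γ f b) (hb : 0 < b) : Tendsto f atTop (𝓝 0) := by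
  have h1 : Tendsto (fun n => Real.exp (-(γ n * b))) atTop (𝓝 0) :=
    Real.tendsto_exp_neg_atTop_nhds_zero.comp (hγ.atTop_mul_const hb)
  have h2 := ENNReal.tendsto_ofReal h1
  rw [ENNReal.ofReal_zero] at h2
  exact tendsto_of_tendsto_of_tendsto_of_le_of_le' tendsto_const_nhds h2
    (Eventually.of_forall fun _ => zero_le) h

lemma coe_lt_ennreal_iff (b : ℝ) (x : ℝ≥0∞) :
    (b : EReal) < (x : EReal) ↔ b < 0 ∨ ENNReal.ofReal b < x := by
  rcases lt_or_ge b 0 with hb | hb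
  · simp only [hb, true_or, iff_true]
    exact lt_of_lt_of_le (by exact_mod_cast hb) (EReal.coe_ennreal_nonneg x)
  · have : (b : EReal) = ((ENNReal.ofReal b : ℝ≥0∞) : EReal) := by
      rw [EReal.coe_ennreal_ofReal, max_eq_left hb]
    rw [this, EReal.coe_ennreal_lt_coe_ennreal_iff]
    simp [not_lt.2 hb]

lemma isOpen_coe_lt {E : Type*} [TopologicalSpace E] {I : E → ℝ≥0∞}
    (hI : LowerSemicontinuous I) (b : ℝ) : IsOpen {y | (b : EReal) < (I y : EReal)} := by
  simp only [coe_lt_ennreal_iff]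
  by_cases hb : b < 0
  · simp [hb]
  · have := hI.isOpen_preimage (ENNReal.ofReal b)
    simp only [hb, false_or]
    exact this

lemma coe_nn (x : ℝ≥0) : (((x : ℝ≥0∞)) : EReal) = ((x : ℝ) : EReal) := rfl

lemma split_lt (b : ℝ) (x y : ℝ≥0∞) (h : (b : EReal) < ((x + y : ℝ≥0∞) : EReal)) :
    ∃ b1 b2 : ℝ, b1 + b2 = b ∧ (b1 : EReal) < x ∧ (b2 : EReal) < y := by
  have hneg : ∀ z : ℝ≥0∞, ((-1 : ℝ) : EReal) < z := fun z =>
    (coe_lt_ennreal_iff _ _).2 (Or.inl (by norm_num))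
  rcases eq_or_ne x ⊤ with rfl | hx
  · exact ⟨b + 1, -1, by ring, EReal.coe_lt_top _, hneg _⟩
  rcases eq_or_ne y ⊤ with rfl | hy
  · exact ⟨-1, b + 1, by ring, hneg _, EReal.coe_lt_top _⟩
  lift x to ℝ≥0 using hx
  lift y to ℝ≥0 using hy
  have h' : b < (x : ℝ) + y := by
    rw [← ENNReal.coe_add, coe_nn, EReal.coe_lt_coe_iff] at h
    exact_mod_cast h
  refine ⟨x - (x + y - b) / 2, y - (x + y - b) / 2, by ring, ?_, ?_⟩
  · have : (x : ℝ) - (x + y - b) / 2 < x := by linarith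
    rw [coe_nn]; exact EReal.coe_lt_coe_iff.2 this
  · have : (y : ℝ) - (x + y - b) / 2 < y := by linarith
    rw [coe_nn]; exact EReal.coe_lt_coe_iff.2 this

lemma split_gt (b : ℝ) (x y : ℝ≥0∞) (h : ((x + y : ℝ≥0∞) : EReal) < (b : EReal)) :
    ∃ b1 b2 : ℝ, b1 + b2 = b ∧ (x : EReal) < b1 ∧ (y : EReal) < b2 := by
  have hxy : x + y ≠ ⊤ := by
    intro h'
    rw [h'] at h
    exact absurd h (by simp)
  have hx : x ≠ ⊤ := fun h' => hxy (by simp [h'])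
  have hy : y ≠ ⊤ := fun h' => hxy (by simp [h'])
  lift x to ℝ≥0 using hx
  lift y to ℝ≥0 using hy
  have h' : (x : ℝ) + y < b := by
    rw [← ENNReal.coe_add, coe_nn, EReal.coe_lt_coe_iff] at h
    exact_mod_cast h
  refine ⟨x + (b - x - y) / 2, y + (b - x - y) / 2, by ring, ?_, ?_⟩
  · have : (x : ℝ) < x + (b - x - y) / 2 := by linarith
    rw [coe_nn]; exact EReal.coe_lt_coe_iff.2 this
  · have : (y : ℝ) < y + (b - x - y) / 2 := by linarith
    rw [coe_nn]; exact EReal.coe_lt_coe_iff.2 this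

lemma exists_between_coe (b : ℝ) (x : ℝ≥0∞) (h : (b : EReal) < x) :
    ∃ c : ℝ, b < c ∧ (c : EReal) < x := by
  obtain ⟨c, h1, h2⟩ := EReal.lt_iff_exists_real_btwn.1 h
  exact ⟨c, by exact_mod_cast h1, h2⟩

lemma prod_upper {Ω E F : Type*} [MeasurableSpace Ω] [TopologicalSpace E] [RegularSpace E]
    [MeasurableSpace E] [OpensMeasurableSpace E] [TopologicalSpace F] [MeasurableSpace F]
    [OpensMeasurableSpace F] (P : Measure Ω) {γ : ℕ → ℝ} (hγ : Tendsto γ atTop atTop)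
    (Y : ℕ → Ω → E) (X : ℕ → Ω → F) (hind : ∀ n, IndepFun (Y n) (X n) P)
    (IY : E → ℝ≥0∞) (J : F → ℝ≥0∞) (hgood : GoodRate IY)
    (hYub : ∀ C : Set E, IsClosed C → ∀ b : ℝ, (∀ y ∈ C, (b : EReal) < IY y) →
      ∀ b' < b, UBd γ (fun n => P (Y n ⁻¹' C)) b')
    (hXloc : ∀ x, ∀ b : ℝ, (b : EReal) < J x → ∃ V : Set F, IsOpen V ∧ x ∈ V ∧
      UBd γ (fun n => P (X n ⁻¹' V)) b)
    (hK : ∀ R : ℝ, 0 < R → ∃ K : Set F, IsCompact K ∧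
      ∀ b' < R, UBd γ (fun n => P (X n ⁻¹' Kᶜ)) b')
    (Γ : Set (E × F)) (hΓ : IsClosed Γ) (b : ℝ)
    (hb : ∀ p ∈ Γ, (b : EReal) < ((IY p.1 + J p.2 : ℝ≥0∞) : EReal)) (b' : ℝ) (hb' : b' < b) :
    UBd γ (fun n => P {ω | (Y n ω, X n ω) ∈ Γ}) b' := by
  set a : ℝ≥0 := Real.toNNReal b + 1 with ha
  have hab : b < a := by
    rw [ha]; push_cast
    have := Real.le_coe_toNNReal b
    linarith
  obtain ⟨K, hKc, hKub⟩ := hK (|b| + 1) (by positivity)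
  have hSc := hgood.2 a
  set S := {x | IY x ≤ (a : ℝ≥0∞)} with hS
  have hcomp : IsCompact (Γ ∩ S ×ˢ K) := (hSc.prod hKc).inter_left hΓ
  have key : ∃ O : Set (E × F), IsOpen O ∧ Γ ∩ S ×ˢ K ⊆ O ∧
      ∀ c < b, UBd γ (fun n => P {ω | (Y n ω, X n ω) ∈ O}) c := by
    refine hcomp.induction_on (p := fun s => ∃ O : Set (E × F), IsOpen O ∧ s ⊆ O ∧
      ∀ c < b, UBd γ (fun n => P {ω | (Y n ω, X n ω) ∈ O}) c) ?_ ?_ ?_ ?_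
    · refine ⟨∅, isOpen_empty, subset_rfl, fun c _ => Eventually.of_forall fun n => ?_⟩
      simp
    · rintro s t hst ⟨O, h1, h2, h3⟩
      exact ⟨O, h1, hst.trans h2, h3⟩
    · rintro s t ⟨O, h1, h2, h3⟩ ⟨O', h1', h2', h3'⟩
      refine ⟨O ∪ O', h1.union h1', Set.union_subset_union h2 h2', fun c hc => ?_⟩
      obtain ⟨d, hcd, hdb⟩ := exists_between hc
      refine ((h3 d hdb).add hγ (h3' d hdb) hcd).mono fun n => ?_
      exact measure_union_le _ _
    · rintro ⟨y, x⟩ hp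
      obtain ⟨b1, b2, h12, hb1, hb2⟩ := split_lt b _ _ (hb _ hp.1)
      obtain ⟨d, hd, hdI⟩ := exists_between_coe _ _ hb1
      obtain ⟨t, ht, htc, hts⟩ := exists_mem_nhds_isClosed_subset
        ((isOpen_coe_lt hgood.1 d).mem_nhds hdI)
      obtain ⟨V, hV, hxV, hVub⟩ := hXloc x b2 hb2
      have hO : IsOpen (interior t ×ˢ V) := isOpen_interior.prod hV
      refine ⟨interior t ×ˢ V, mem_nhdsWithin_of_mem_nhds
        (hO.mem_nhds ⟨mem_interior_iff_mem_nhds.2 ht, hxV⟩), _, hO, subset_rfl, fun c hc => ?_⟩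
      have hu := (hYub t htc d (fun y hy => hts hy) b1 hd).mul hVub
      rw [h12] at hu
      refine (hu.rate hγ hc.le).mono fun n => ?_
      have := (hind n).measure_inter_preimage_eq_mul _ _ (htc.measurableSet) (hV.measurableSet)
      rw [← this]
      exact measure_mono fun ω hω => ⟨(interior_subset hω.1 : Y n ω ∈ t), hω.2⟩
  obtain ⟨O, hO, hsub, hOub⟩ := key
  obtain ⟨u, v, hu, hv, hSu, hKv, huv⟩ := generalized_tube_lemma hSc hKc
    (n := Γᶜ ∪ O) (hΓ.isOpen_compl.union hO) (by
      intro p hp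
      by_cases h : p ∈ Γ
      · exact Or.inr (hsub ⟨h, hp⟩)
      · exact Or.inl h)
  obtain ⟨c1, hc1, hc1b⟩ := exists_between hb'
  obtain ⟨c2, hc2, hc2b⟩ := exists_between hc1b
  have e1 := hOub c2 hc2b
  have e2 := hYub uᶜ hu.isClosed_compl a (fun y hy => by
    have : y ∉ S := fun h => hy (hSu h)
    simp only [hS, Set.mem_ofPred_eq, not_le] at this
    rw [← coe_nn]
    exact EReal.coe_ennreal_lt_coe_ennreal_iff.2 this) c2 (hc2b.trans hab)
  have e3 := hKub c1 (by linarith [le_abs_self b])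
  refine ((e1.add hγ e2 hc2).add hγ e3 hc1).mono fun n => ?_
  refine (measure_mono (t := ({ω | (Y n ω, X n ω) ∈ O} ∪ Y n ⁻¹' uᶜ) ∪ X n ⁻¹' Kᶜ) ?_).trans
    ((measure_union_le _ _).trans (add_le_add_left (measure_union_le _ _) _))
  intro ω hω
  by_cases h1 : Y n ω ∈ u
  · by_cases h2 : X n ω ∈ K
    · rcases huv (Set.mk_mem_prod h1 (hKv h2)) with h | h
      · exact absurd hω h
      · exact Or.inl (Or.inl h)
    · exact Or.inr h2
  · exact Or.inl (Or.inr h1)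

lemma prod_lower {Ω E F : Type*} [MeasurableSpace Ω] [TopologicalSpace E]
    [MeasurableSpace E] [OpensMeasurableSpace E] [TopologicalSpace F] [MeasurableSpace F]
    [OpensMeasurableSpace F] (P : Measure Ω) {γ : ℕ → ℝ}
    (Y : ℕ → Ω → E) (X : ℕ → Ω → F) (hind : ∀ n, IndepFun (Y n) (X n) P)
    (IY : E → ℝ≥0∞) (J : F → ℝ≥0∞)
    (hYlb : ∀ U : Set E, IsOpen U → ∀ y ∈ U, ∀ b : ℝ, (IY y : EReal) < b →
      LBd γ (fun n => P (Y n ⁻¹' U)) b)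
    (hXlb : ∀ V : Set F, IsOpen V → ∀ x ∈ V, ∀ b : ℝ, (J x : EReal) < b →
      LBd γ (fun n => P (X n ⁻¹' V)) b)
    (Θ : Set (E × F)) (hΘ : IsOpen Θ) (p : E × F) (hp : p ∈ Θ) (b : ℝ)
    (hb : ((IY p.1 + J p.2 : ℝ≥0∞) : EReal) < b) :
    LBd γ (fun n => P {ω | (Y n ω, X n ω) ∈ Θ}) b := by
  obtain ⟨b1, b2, h12, hb1, hb2⟩ := split_gt b _ _ hb
  obtain ⟨U, V, hU, hV, hyU, hxV, hUV⟩ := isOpen_prod_iff.1 hΘ p.1 p.2 hp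
  have := (hYlb U hU _ hyU b1 hb1).mul (hXlb V hV _ hxV b2 hb2)
  rw [h12] at this
  refine this.mono fun n => ?_
  rw [← (hind n).measure_inter_preimage_eq_mul _ _ hU.measurableSet hV.measurableSet]
  exact measure_mono fun ω hω => hUV ⟨hω.1, hω.2⟩

lemma integrable_of_continuous_UI (μ : Measure UI) [IsFiniteMeasure μ] {f : UI → ℝ}
    (hf : Continuous f) : Integrable f μ := by
  have := hf.continuousOn.integrableOn_compact (μ := μ) (isCompact_univ : IsCompact (Set.univ : Set UI))
  rwa [integrableOn_univ] at this

lemma pairSM_of_sub (lam : SignedMeasure UI) (μ ν : Measure UI) [IsFiniteMeasure μ]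
    [IsFiniteMeasure ν] (h : lam = μ.toSignedMeasure - ν.toSignedMeasure) {f : UI → ℝ}
    (hf : Continuous f) : pairSM lam f = ∫ t, f t ∂μ - ∫ t, f t ∂ν := by
  have h1 := lam.toSignedMeasure_toJordanDecomposition
  unfold JordanDecomposition.toSignedMeasure at h1
  have h2 : (lam.toJordanDecomposition.posPart + ν) = (lam.toJordanDecomposition.negPart + μ) := by
    rw [← Measure.toSignedMeasure_eq_toSignedMeasure_iff, Measure.toSignedMeasure_add,
      Measure.toSignedMeasure_add]
    have h3 := h1.trans h
    rw [sub_eq_sub_iff_add_eq_add] at h3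
    rw [h3, add_comm]
  have h3 : ∫ t, f t ∂(lam.toJordanDecomposition.posPart + ν) =
      ∫ t, f t ∂(lam.toJordanDecomposition.negPart + μ) := by rw [h2]
  rw [integral_add_measure (integrable_of_continuous_UI _ hf) (integrable_of_continuous_UI _ hf),
    integral_add_measure (integrable_of_continuous_UI _ hf) (integrable_of_continuous_UI _ hf)] at h3
  unfold pairSM
  linarith

lemma pairSM_add (l m : SignedMeasure UI) {f : UI → ℝ} (hf : Continuous f) :
    pairSM (l + m) f = pairSM l f + pairSM m f := by
  have h1 := l.toSignedMeasure_toJordanDecomposition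
  have h2 := m.toSignedMeasure_toJordanDecomposition
  unfold JordanDecomposition.toSignedMeasure at h1 h2
  rw [pairSM_of_sub (l + m) (l.toJordanDecomposition.posPart + m.toJordanDecomposition.posPart)
    (l.toJordanDecomposition.negPart + m.toJordanDecomposition.negPart) ?_ hf,
    integral_add_measure (integrable_of_continuous_UI _ hf) (integrable_of_continuous_UI _ hf),
    integral_add_measure (integrable_of_continuous_UI _ hf) (integrable_of_continuous_UI _ hf)]
  · unfold pairSM; ring
  · rw [Measure.toSignedMeasure_add, Measure.toSignedMeasure_add]
    nth_rw 1 [← h1, ← h2]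
    abel

lemma pairSM_zero (f : UI → ℝ) : pairSM 0 f = 0 := by
  simp [pairSM, SignedMeasure.toJordanDecomposition_zero]

lemma pairSM_smul (r : ℝ) (l : SignedMeasure UI) (f : UI → ℝ) :
    pairSM (r • l) f = r * pairSM l f := by
  unfold pairSM
  rw [SignedMeasure.toJordanDecomposition_smul_real]
  rcases le_or_gt 0 r with hr | hr
  · rw [JordanDecomposition.real_smul_posPart_nonneg _ _ hr,
      JordanDecomposition.real_smul_negPart_nonneg _ _ hr]
    simp only [integral_smul_nnreal_measure, NNReal.smul_def, Real.coe_toNNReal _ hr, smul_eq_mul]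
    ring
  · rw [JordanDecomposition.real_smul_posPart_neg _ _ hr,
      JordanDecomposition.real_smul_negPart_neg _ _ hr]
    simp only [integral_smul_nnreal_measure, NNReal.smul_def,
      Real.coe_toNNReal _ (neg_nonneg.2 hr.le), smul_eq_mul]
    ring

/-- The pairing with a signed measure bounds: Lipschitz in sup norm. -/
lemma continuous_pairSM (l : SignedMeasure UI) : Continuous fun f : CC => pairSM l f := by
  unfold pairSM
  have : ∀ μ : Measure UI, IsFiniteMeasure μ → Continuous fun f : CC => ∫ t, f t ∂μ := by
    intro μ _
    refine continuous_iff_continuousAt.2 fun f => ?_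
    refine LipschitzWith.continuous (K := (μ.real Set.univ).toNNReal) ?_ |>.continuousAt
    refine LipschitzWith.of_dist_le_mul fun f g => ?_
    rw [Real.coe_toNNReal _ measureReal_nonneg, dist_eq_norm, ← integral_sub
      (integrable_of_continuous_UI _ f.continuous) (integrable_of_continuous_UI _ g.continuous)]
    rw [mul_comm]
    refine norm_integral_le_of_norm_le_const (Eventually.of_forall fun t => ?_)
    rw [← dist_eq_norm]
    exact ContinuousMap.dist_apply_le_dist t
  exact (this _ inferInstance).sub (this _ inferInstance)

/-- Dirac signed measure. -/
def dirSM (t : UI) : SignedMeasure UI := (Measure.dirac t).toSignedMeasure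

lemma pairSM_dirSM (t : UI) {f : UI → ℝ} (hf : Continuous f) : pairSM (dirSM t) f = f t := by
  rw [pairSM_of_sub (dirSM t) (Measure.dirac t) 0 (by simp [dirSM]) hf]
  simp

/-- Discrete signed measures. -/
def dm : (UI →₀ ℝ) →ₗ[ℝ] SignedMeasure UI := Finsupp.linearCombination ℝ dirSM

lemma pairSM_dm (c : UI →₀ ℝ) {f : UI → ℝ} (hf : Continuous f) :
    pairSM (dm c) f = Finsupp.linearCombination ℝ f c := by
  induction c using Finsupp.induction_linear with
  | zero => simp [pairSM_zero]
  | add c d hc hd => rw [map_add, pairSM_add _ _ hf, hc, hd, map_add]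
  | single t r => simp [dm, pairSM_smul, pairSM_dirSM t hf]

lemma dblInt_dm {H : Type*} [NormedAddCommGroup H] [InnerProductSpace ℝ H] (k : UI → UI → ℝ)
    (Φ : UI → H) (hΦ : Continuous Φ) (hk : ∀ s t, k s t = inner ℝ (Φ s) (Φ t)) (c : UI →₀ ℝ) :
    dblInt (dm c) k = ‖Finsupp.linearCombination ℝ Φ c‖ ^ 2 := by
  have key : ∀ (w : H) (c : UI →₀ ℝ), pairSM (dm c) (fun s => inner ℝ w (Φ s)) =
      inner ℝ w (Finsupp.linearCombination ℝ Φ c) := by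
    intro w c
    rw [pairSM_dm _ (by fun_prop)]
    simp [Finsupp.linearCombination_apply, Finsupp.sum, inner_sum, inner_smul_right]
  unfold dblInt
  simp only [hk, key]
  have h2 : (fun t => inner ℝ (Φ t) (Finsupp.linearCombination ℝ Φ c)) =
      fun t => inner ℝ (Finsupp.linearCombination ℝ Φ c) (Φ t) :=
    funext fun t => real_inner_comm _ _
  rw [h2, key, real_inner_self_eq_norm_sq]

lemma measurable_pair {Ω : Type*} [MeasurableSpace Ω] {X : Ω → CC} (hX : Measurable X)
    (l : SignedMeasure UI) : Measurable fun ω => pairSM l (X ω) :=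
  (continuous_pairSM l).measurable.comp hX

lemma gauss_mgf {Ω : Type*} [MeasurableSpace Ω] (P : Measure Ω) [IsProbabilityMeasure P]
    {X : Ω → CC} (hX : IsContGaussian P X) (hc : IsCentered P X) (l : SignedMeasure UI)
    (s r : ℝ) :
    ∫⁻ ω, ENNReal.ofReal (Real.exp (s * pairSM l (X ω) + r)) ∂P =
      ENNReal.ofReal (Real.exp (s ^ 2 * variance (fun ω => pairSM l (X ω)) P / 2 + r)) := by
  obtain ⟨m, v, h⟩ := hX.2 l
  have hm := measurable_pair hX.1 l
  have hmean : m = 0 := by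
    have h1 : ∫ x, x ∂(P.map fun ω => pairSM l (X ω)) = ∫ ω, pairSM l (X ω) ∂P :=
      integral_map hm.aemeasurable (by fun_prop)
    rw [h, integral_id_gaussianReal, hc l] at h1
    exact h1
  have hvar : variance (fun ω => pairSM l (X ω)) P = v := by
    have h1 := variance_map (μ := P) (X := id) (Y := fun ω => pairSM l (X ω)) (by fun_prop)
      hm.aemeasurable
    rw [h, variance_id_gaussianReal] at h1
    exact h1.symm
  have hintg : Integrable (fun ω => Real.exp (s * pairSM l (X ω))) P := by
    have h1 : Integrable (fun x => Real.exp (s * x)) (P.map fun ω => pairSM l (X ω)) := by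
      rw [h]; exact integrable_exp_mul_gaussianReal s
    exact (integrable_map_measure (by fun_prop) hm.aemeasurable).1 h1
  have hmgf := mgf_gaussianReal h s
  unfold mgf at hmgf
  have hintg2 : Integrable (fun ω => Real.exp (s * pairSM l (X ω) + r)) P := by
    simp_rw [Real.exp_add]; exact hintg.mul_const _
  rw [← ofReal_integral_eq_lintegral_ofReal hintg2
    (Eventually.of_forall fun _ => (Real.exp_pos _).le)]
  simp_rw [Real.exp_add]
  rw [integral_mul_const, hmgf, hmean, hvar]
  congr 3
  ring_nf

lemma tilt_le {Ω : Type*} [MeasurableSpace Ω] (P : Measure Ω) {A : Set Ω}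
    (hA : MeasurableSet A) (f g : Ω → ℝ) (h : ∀ ω ∈ A, f ω ≤ g ω) :
    ∫⁻ ω in A, ENNReal.ofReal (Real.exp (f ω)) ∂P ≤ ∫⁻ ω, ENNReal.ofReal (Real.exp (g ω)) ∂P :=
  (setLIntegral_mono' hA fun ω hω =>
    ENNReal.ofReal_le_ofReal (Real.exp_le_exp.2 (h ω hω))).trans (setLIntegral_le_lintegral _ _)

lemma gauss_local_upper {Ω : Type*} [MeasurableSpace Ω] (P : Measure Ω) [IsProbabilityMeasure P]
    {γ : ℕ → ℝ} (hγ : Tendsto γ atTop atTop) {X : ℕ → Ω → CC} {k : UI → UI → ℝ}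
    (hG : HypG P X γ k) (x : CC) (b : ℝ) (hb : (b : EReal) < CramerK k x) :
    ∃ V : Set CC, IsOpen V ∧ x ∈ V ∧ UBd γ (fun n => P (X n ⁻¹' V)) b := by
  rcases (coe_lt_ennreal_iff _ _).1 hb with hb | hb
  · refine ⟨Set.univ, isOpen_univ, trivial, ?_⟩
    filter_upwards [hγ.eventually_ge_atTop 0] with n hn
    refine prob_le_one.trans ?_
    rw [← ENNReal.ofReal_one]
    refine ENNReal.ofReal_le_ofReal (Real.one_le_exp ?_)
    nlinarith
  · obtain ⟨l, hl⟩ := lt_iSup_iff.1 hb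
    have hl' : b < pairSM l x - LamK k l :=
      lt_of_not_ge fun h => hl.not_ge (ENNReal.ofReal_le_ofReal h)
    obtain ⟨c, hbc, hc⟩ := exists_between hl'
    have hVo : IsOpen {g : CC | c + LamK k l < pairSM l g} :=
      isOpen_lt continuous_const (continuous_pairSM l)
    refine ⟨{g : CC | c + LamK k l < pairSM l g}, hVo,
      (by linarith : c + LamK k l < pairSM l x), ?_⟩
    have hT := hG.2.2.2.2.2 l
    have hlam : dblInt l k = 2 * LamK k l := by unfold LamK; ring
    have hlt : dblInt l k < 2 * (LamK k l + (c - b)) := by linarith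
    filter_upwards [hT.eventually_lt_const hlt, hγ.eventually_gt_atTop 0] with n hn hg
    have hm : MeasurableSet (X n ⁻¹' {g : CC | c + LamK k l < pairSM l g}) :=
      (hG.1 n).1 hVo.measurableSet
    have h1 := tilt_le P hm (fun _ => 0)
      (fun ω => γ n * pairSM l (X n ω) + -(γ n * (c + LamK k l))) (fun ω hω => by
        have hω' : c + LamK k l < pairSM l (X n ω) := hω
        nlinarith)
    rw [gauss_mgf P (hG.1 n) (hG.2.1 n)] at h1
    simp only [Real.exp_zero, ENNReal.ofReal_one, lintegral_const, one_mul,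
      Measure.restrict_apply MeasurableSet.univ, Set.univ_inter] at h1
    refine h1.trans (ENNReal.ofReal_le_ofReal (Real.exp_le_exp.2 ?_))
    nlinarith

/-- Exponentially tilted measure of the set `A`. -/
def tq {Ω : Type*} [MeasurableSpace Ω] (P : Measure Ω) (X : Ω → CC) (l : SignedMeasure UI)
    (g : ℝ) (A : Set Ω) : ℝ≥0∞ :=
  ∫⁻ ω in A, ENNReal.ofReal (Real.exp (g * pairSM l (X ω) +
    -(g ^ 2 * variance (fun ω => pairSM l (X ω)) P / 2))) ∂P

lemma tq_mono {Ω : Type*} [MeasurableSpace Ω] (P : Measure Ω) (X : Ω → CC) (l : SignedMeasure UI)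
    (g : ℝ) {A B : Set Ω} (h : A ⊆ B) : tq P X l g A ≤ tq P X l g B :=
  lintegral_mono_set h

lemma tq_union {Ω : Type*} [MeasurableSpace Ω] (P : Measure Ω) (X : Ω → CC) (l : SignedMeasure UI)
    (g : ℝ) (A B : Set Ω) : tq P X l g (A ∪ B) ≤ tq P X l g A + tq P X l g B :=
  lintegral_union_le _ _ _

lemma tq_univ {Ω : Type*} [MeasurableSpace Ω] (P : Measure Ω) [IsProbabilityMeasure P]
    {X : Ω → CC} (hX : IsContGaussian P X) (hc : IsCentered P X) (l : SignedMeasure UI)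
    (g : ℝ) : tq P X l g Set.univ = 1 := by
  unfold tq
  rw [setLIntegral_univ, gauss_mgf P hX hc]
  simp

lemma tq_halfspace {Ω : Type*} [MeasurableSpace Ω] (P : Measure Ω) [IsProbabilityMeasure P]
    {γ : ℕ → ℝ} (hγ : Tendsto γ atTop atTop) {X : ℕ → Ω → CC} {k : UI → UI → ℝ}
    (hG : HypG P X γ k) {H : Type*} [NormedAddCommGroup H] [InnerProductSpace ℝ H]
    (Φ : UI → H) (hΦ : Continuous Φ) (hk : ∀ s t, k s t = inner ℝ (Φ s) (Φ t))
    (c : UI →₀ ℝ) (h : CC)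
    (hh : ∀ t, h t = inner ℝ (Finsupp.linearCombination ℝ Φ c) (Φ t))
    (t : UI) (ε : ℝ) (hε : 0 < ε) (σ : ℝ) (hσ : σ ^ 2 = 1) :
    Tendsto (fun n => tq P (X n) (dm c) (γ n) (X n ⁻¹' {g : CC | ε < σ * (g t - h t)})) atTop
      (𝓝 0) := by
  set w := Finsupp.linearCombination ℝ Φ c with hw
  set κ := ‖Φ t‖ ^ 2 with hκ
  have hκ0 : 0 ≤ κ := by positivity
  set s := ε / (κ + 1) with hs
  have hs0 : 0 < s := by positivity
  have hsκ : s * κ ≤ ε := by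
    rw [hs, div_mul_eq_mul_div, div_le_iff₀ (by positivity)]; nlinarith
  set d := c + Finsupp.single t (s * σ) with hd
  have hD := hG.2.2.2.2.2 (dm c)
  have hD' := hG.2.2.2.2.2 (dm d)
  rw [dblInt_dm k Φ hΦ hk] at hD hD'
  have hD'v : ‖Finsupp.linearCombination ℝ Φ d‖ ^ 2 = ‖w‖ ^ 2 + 2 * (s * σ) * h t + s ^ 2 * κ := by
    rw [hd, map_add, ← hw, Finsupp.linearCombination_single, norm_add_sq_real, inner_smul_right,
      norm_smul, mul_pow, hh t, Real.norm_eq_abs, sq_abs, mul_pow, hσ]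
    ring
  rw [hD'v] at hD'
  have hlim := hD'.sub hD
  have hlt : ‖w‖ ^ 2 + 2 * (s * σ) * h t + s ^ 2 * κ - ‖w‖ ^ 2 <
      2 * (s * σ * h t + s * ε - s * ε / 4) := by nlinarith [mul_pos hs0 hε]
  have hub : UBd γ (fun n => tq P (X n) (dm c) (γ n) (X n ⁻¹' {g : CC | ε < σ * (g t - h t)}))
      (s * ε / 4) := by
    filter_upwards [hlim.eventually_lt_const hlt, hγ.eventually_gt_atTop 0] with n hn hg
    have hVo : IsOpen {g : CC | ε < σ * (g t - h t)} :=
      isOpen_lt continuous_const (by fun_prop)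
    have hm := (hG.1 n).1 hVo.measurableSet
    unfold tq
    have h1 := tilt_le P hm (fun ω => γ n * pairSM (dm c) (X n ω) +
      -(γ n ^ 2 * variance (fun ω => pairSM (dm c) (X n ω)) P / 2))
      (fun ω => γ n * pairSM (dm d) (X n ω) + (-(γ n * (s * σ * h t + s * ε)) +
      -(γ n ^ 2 * variance (fun ω => pairSM (dm c) (X n ω)) P / 2))) (fun ω hω => by
        have hω' : ε < σ * (X n ω t - h t) := hω
        have e : pairSM (dm d) (X n ω) = pairSM (dm c) (X n ω) + s * σ * X n ω t := by
          rw [hd, map_add, pairSM_add _ _ (X n ω).continuous]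
          rw [pairSM_dm (Finsupp.single t (s * σ)) (X n ω).continuous,
            Finsupp.linearCombination_single, smul_eq_mul]
        rw [e]
        nlinarith [mul_pos hg hs0])
    rw [gauss_mgf P (hG.1 n) (hG.2.1 n)] at h1
    refine h1.trans (ENNReal.ofReal_le_ofReal (Real.exp_le_exp.2 ?_))
    nlinarith
  exact hub.tendsto_zero hγ (by positivity)

lemma tq_compl {Ω : Type*} [MeasurableSpace Ω] (P : Measure Ω) [IsProbabilityMeasure P]
    {γ : ℕ → ℝ} (hγ : Tendsto γ atTop atTop) {X : ℕ → Ω → CC} {k : UI → UI → ℝ}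
    (hG : HypG P X γ k) (l : SignedMeasure UI) :
    ∃ K : Set CC, IsCompact K ∧
      Tendsto (fun n => tq P (X n) l (γ n) (X n ⁻¹' Kᶜ)) atTop (𝓝 0) := by
  set D := dblInt l k with hDdef
  have hD := hG.2.2.2.2.2 l
  set M := 2 * D + 3 with hM
  obtain ⟨K, hK, hKub⟩ := hG.2.2.1 (|M| + 2) (by positivity)
  refine ⟨K, hK, ?_⟩
  have h1 := UBd_of_limsup_le hγ (fun n => P (X n ⁻¹' Kᶜ)) ((|M| + 2 : ℝ) : EReal)
    (by rw [← EReal.coe_neg]; exact hKub) (M + 1)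
    (EReal.coe_lt_coe_iff.2 (by linarith [le_abs_self M]))
  have h2 : UBd γ (fun n => ENNReal.ofReal (Real.exp (γ n * M)) * P (X n ⁻¹' Kᶜ)) 1 := by
    have h0 : UBd γ (fun n => ENNReal.ofReal (Real.exp (γ n * M))) (-M) :=
      Eventually.of_forall fun n => by simp
    have := h0.mul h1
    rwa [neg_add_cancel_left] at this
  have h3 : UBd γ (fun n => ENNReal.ofReal (Real.exp ((2 * γ n) ^ 2 *
      variance (fun ω => pairSM l (X n ω)) P / 2 + -(γ n * M)))) 1 := by
    filter_upwards [hD.eventually_lt_const (show D < D + 1 by linarith),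
      hγ.eventually_gt_atTop 0] with n hn hg
    refine ENNReal.ofReal_le_ofReal (Real.exp_le_exp.2 ?_)
    nlinarith
  have h4 : UBd γ (fun n => tq P (X n) l (γ n) (X n ⁻¹' Kᶜ)) (1 / 2) := by
    refine (h2.add hγ h3 (by norm_num)).mono fun n => ?_
    have hm : MeasurableSet (X n ⁻¹' Kᶜ) := (hG.1 n).1 hK.isClosed.measurableSet.compl
    have hv := variance_nonneg (fun ω => pairSM l (X n ω)) P
    have e : ∫⁻ ω in X n ⁻¹' Kᶜ, ENNReal.ofReal (Real.exp (γ n * M)) ∂P =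
        ENNReal.ofReal (Real.exp (γ n * M)) * P (X n ⁻¹' Kᶜ) := by
      rw [setLIntegral_const]
    rw [← gauss_mgf P (hG.1 n) (hG.2.1 n), ← e]
    refine le_trans ?_ (add_le_add_right (setLIntegral_le_lintegral (X n ⁻¹' Kᶜ) _) _)
    rw [← lintegral_add_left (by fun_prop)]
    unfold tq
    refine lintegral_mono fun ω => ?_
    rw [← ENNReal.ofReal_add (Real.exp_pos _).le (Real.exp_pos _).le]
    apply ENNReal.ofReal_le_ofReal
    set L := pairSM l (X n ω)
    have hv' : 0 ≤ γ n ^ 2 * variance (fun ω => pairSM l (X n ω)) P / 2 := by positivity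
    rcases le_total (γ n * L) (γ n * M) with hLM | hLM
    · have : Real.exp (γ n * L + -(γ n ^ 2 * variance (fun ω => pairSM l (X n ω)) P / 2)) ≤
        Real.exp (γ n * M) := Real.exp_le_exp.2 (by linarith)
      linarith [Real.exp_pos (2 * γ n * L + -(γ n * M))]
    · have : Real.exp (γ n * L + -(γ n ^ 2 * variance (fun ω => pairSM l (X n ω)) P / 2)) ≤
        Real.exp (2 * γ n * L + -(γ n * M)) := Real.exp_le_exp.2 (by linarith)
      linarith [Real.exp_pos (γ n * M)]
  exact h4.tendsto_zero hγ (by norm_num)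

lemma gauss_lower_discrete {Ω : Type*} [MeasurableSpace Ω] (P : Measure Ω) [IsProbabilityMeasure P]
    {γ : ℕ → ℝ} (hγ : Tendsto γ atTop atTop) {X : ℕ → Ω → CC} {k : UI → UI → ℝ}
    (hG : HypG P X γ k) {H : Type*} [NormedAddCommGroup H] [InnerProductSpace ℝ H]
    (Φ : UI → H) (hΦ : Continuous Φ) (hk : ∀ s t, k s t = inner ℝ (Φ s) (Φ t))
    (c : UI →₀ ℝ) (h : CC)
    (hh : ∀ t, h t = inner ℝ (Finsupp.linearCombination ℝ Φ c) (Φ t))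
    (V : Set CC) (hV : IsOpen V) (hhV : h ∈ V) (b : ℝ)
    (hb : ‖Finsupp.linearCombination ℝ Φ c‖ ^ 2 / 2 < b) :
    LBd γ (fun n => P (X n ⁻¹' V)) b := by
  set w := Finsupp.linearCombination ℝ Φ c with hw
  set D := ‖w‖ ^ 2 with hDdef
  set δ := (b - D / 2) / 2 with hδ
  have hδ0 : 0 < δ := by linarith
  have hD := hG.2.2.2.2.2 (dm c)
  rw [dblInt_dm k Φ hΦ hk, ← hw, ← hDdef] at hD
  have hpair : pairSM (dm c) h = D := by
    rw [pairSM_dm _ h.continuous, hDdef, ← real_inner_self_eq_norm_sq]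
    nth_rw 2 [hw]
    simp [Finsupp.linearCombination_apply, Finsupp.sum, inner_sum, inner_smul_right, hh]
  set V' := V ∩ {g : CC | pairSM (dm c) g < D + δ} with hV'
  have hV'o : IsOpen V' := hV.inter (isOpen_lt (continuous_pairSM _) continuous_const)
  have hhV' : h ∈ V' := ⟨hhV, (by linarith : pairSM (dm c) h < D + δ)⟩
  obtain ⟨K, hK, hKq⟩ := tq_compl P hγ hG (dm c)
  have hcomp : IsCompact (K ∩ V'ᶜ) := hK.inter_right hV'o.isClosed_compl
  have hq1 : Tendsto (fun n => tq P (X n) (dm c) (γ n) (X n ⁻¹' (K ∩ V'ᶜ))) atTop (𝓝 0) := by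
    refine hcomp.induction_on
      (p := fun s => Tendsto (fun n => tq P (X n) (dm c) (γ n) (X n ⁻¹' s)) atTop (𝓝 0)) ?_ ?_ ?_ ?_
    · simp [tq]
    · intro s t hst ht
      exact tendsto_of_tendsto_of_tendsto_of_le_of_le tendsto_const_nhds ht
        (fun _ => zero_le) (fun n => tq_mono _ _ _ _ (Set.preimage_mono hst))
    · intro s t hs ht
      have := hs.add ht
      rw [add_zero] at this
      exact tendsto_of_tendsto_of_tendsto_of_le_of_le tendsto_const_nhds this
        (fun _ => zero_le) (fun n => tq_union _ _ _ _ _ _)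
    · intro x hx
      have hne : x ≠ h := fun e => hx.2 (e ▸ hhV')
      obtain ⟨t, ht⟩ : ∃ t, x t ≠ h t := by
        by_contra hcon
        push Not at hcon
        exact hne (ContinuousMap.ext hcon)
      have hgen : ∀ σ : ℝ, σ ^ 2 = 1 → 0 < σ * (x t - h t) →
          ∃ t ∈ 𝓝[K ∩ V'ᶜ] x, Tendsto (fun n => tq P (X n) (dm c) (γ n) (X n ⁻¹' t)) atTop
            (𝓝 0) := by
        intro σ hσ hpos
        refine ⟨{g : CC | σ * (x t - h t) / 2 < σ * (g t - h t)}, mem_nhdsWithin_of_mem_nhds ?_,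
          tq_halfspace P hγ hG Φ hΦ hk c h hh t _ (by positivity) σ hσ⟩
        refine IsOpen.mem_nhds (isOpen_lt continuous_const (by fun_prop)) ?_
        exact (by linarith : σ * (x t - h t) / 2 < σ * (x t - h t))
      rcases lt_or_gt_of_ne ht with hlt | hgt
      · exact hgen (-1) (by norm_num) (by linarith)
      · exact hgen 1 (by norm_num) (by linarith)
  have hq := hq1.add hKq
  rw [add_zero] at hq
  have hhalf : (0 : ℝ≥0∞) < 1 / 2 := by simp
  filter_upwards [hq.eventually_lt_const hhalf,
    hD.eventually_const_lt (show D - δ < D by linarith),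
    hγ.eventually_gt_atTop 0, hγ.eventually_ge_atTop (Real.log 2 / (δ / 2))] with n hn hvn hg hg2
  by_contra hcon
  push Not at hcon
  rw [div_le_iff₀ (by linarith)] at hg2
  have htot : (1 : ℝ≥0∞) ≤ tq P (X n) (dm c) (γ n) (X n ⁻¹' V') +
      (tq P (X n) (dm c) (γ n) (X n ⁻¹' (K ∩ V'ᶜ)) + tq P (X n) (dm c) (γ n) (X n ⁻¹' Kᶜ)) := by
    rw [← tq_univ P (hG.1 n) (hG.2.1 n) (dm c) (γ n)]
    refine (tq_mono _ _ _ _ (B := X n ⁻¹' V' ∪ (X n ⁻¹' (K ∩ V'ᶜ) ∪ X n ⁻¹' Kᶜ)) ?_).trans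
      ((tq_union _ _ _ _ _ _).trans (by gcongr; exact tq_union _ _ _ _ _ _))
    intro ω _
    by_cases h1 : X n ω ∈ V'
    · exact Or.inl h1
    · by_cases h2 : X n ω ∈ K
      · exact Or.inr (Or.inl ⟨h2, h1⟩)
      · exact Or.inr (Or.inr h2)
  have hV'q : tq P (X n) (dm c) (γ n) (X n ⁻¹' V') ≤ 1 / 2 := by
    have hm : MeasurableSet (X n ⁻¹' V') := (hG.1 n).1 hV'o.measurableSet
    set v := variance (fun ω => pairSM (dm c) (X n ω)) P with hv
    have h1 : tq P (X n) (dm c) (γ n) (X n ⁻¹' V') ≤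
        ∫⁻ ω in X n ⁻¹' V', ENNReal.ofReal (Real.exp (γ n * (D + δ) + -(γ n ^ 2 * v / 2))) ∂P := by
      unfold tq
      refine setLIntegral_mono' hm fun ω hω => ?_
      refine ENNReal.ofReal_le_ofReal (Real.exp_le_exp.2 ?_)
      have : pairSM (dm c) (X n ω) < D + δ := hω.2
      rw [← hv]
      nlinarith
    rw [setLIntegral_const] at h1
    refine h1.trans ?_
    have h2 : P (X n ⁻¹' V') ≤ ENNReal.ofReal (Real.exp (-(γ n * b))) :=
      (measure_mono (Set.preimage_mono Set.inter_subset_left)).trans hcon.le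
    refine (mul_le_mul_right h2 _).trans ?_
    rw [← ENNReal.ofReal_mul (Real.exp_pos _).le, ← Real.exp_add]
    have h3 : (1 / 2 : ℝ≥0∞) = ENNReal.ofReal (Real.exp (-Real.log 2)) := by
      rw [Real.exp_neg, Real.exp_log (by norm_num), ENNReal.ofReal_inv_of_pos (by norm_num)]
      simp
    rw [h3]
    refine ENNReal.ofReal_le_ofReal (Real.exp_le_exp.2 ?_)
    have hbD : b = D / 2 + 2 * δ := by rw [hδ]; ring
    rw [hbD]
    nlinarith
  have : (1 : ℝ≥0∞) < 1 / 2 + 1 / 2 := htot.trans_lt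
    (ENNReal.add_lt_add_of_le_of_lt (by simp [ne_top_of_le_ne_top _ hV'q]) hV'q hn)
  simp [ENNReal.inv_two_add_inv_two] at this

lemma exists_feature (k : UI → UI → ℝ) (hk : IsPSDKernel k) (hc : IsCovOfCenteredCGP k) :
    ∃ (H : Type) (_ : NormedAddCommGroup H) (_ : InnerProductSpace ℝ H) (_ : CompleteSpace H)
      (Φ : UI → H), Continuous Φ ∧ ∀ s t, k s t = inner ℝ (Φ s) (Φ t) := by
  obtain ⟨Ω', mΩ, P', U, hP, hU, -, hcov⟩ := hc
  have hmem : ∀ t, MemLp (fun ω => U ω t) 2 P' := by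
    intro t
    obtain ⟨m, v, h⟩ := hU.2 (dirSM t)
    have e : (fun ω => pairSM (dirSM t) (U ω)) = fun ω => U ω t :=
      funext fun ω => pairSM_dirSM t (U ω).continuous
    have hm := measurable_pair hU.1 (dirSM t)
    rw [e] at h hm
    have h1 : MemLp id 2 (P'.map fun ω => U ω t) := by
      rw [h]; exact memLp_id_gaussianReal 2
    exact (memLp_map_measure_iff (by fun_prop) hm.aemeasurable).1 h1
  have hin : ∀ s t, k s t = inner ℝ ((hmem s).toLp) ((hmem t).toLp) := by
    intro s t
    rw [hcov, L2.inner_def]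
    refine integral_congr_ae ?_
    filter_upwards [(hmem s).coeFn_toLp, (hmem t).coeFn_toLp] with ω h1 h2
    rw [h1, h2]
    simp [mul_comm]
  refine ⟨Lp ℝ 2 P', inferInstance, inferInstance, inferInstance, fun t => (hmem t).toLp, ?_, hin⟩
  refine continuous_iff_continuousAt.2 fun t => ?_
  rw [ContinuousAt, tendsto_iff_norm_sub_tendsto_zero]
  have h1 : ∀ s, ‖(hmem s).toLp - (hmem t).toLp‖ = √(k s s - 2 * k s t + k t t) := by
    intro s
    rw [hin, hin, hin, real_inner_self_eq_norm_sq, real_inner_self_eq_norm_sq,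
      ← norm_sub_sq_real, Real.sqrt_sq (norm_nonneg _)]
  simp_rw [h1]
  have h2 : Continuous fun s => √(k s s - 2 * k s t + k t t) := by
    have a1 : Continuous fun s => k s s := hk.1.comp (continuous_id.prodMk continuous_id)
    have a2 : Continuous fun s => k s t := hk.1.comp (continuous_id.prodMk continuous_const)
    exact ((a1.sub (a2.const_mul 2)).add continuous_const).sqrt
  have h3 := h2.tendsto t
  have e : k t t - 2 * k t t + k t t = 0 := by ring
  rwa [e, Real.sqrt_zero] at h3

lemma gauss_lower {Ω : Type*} [MeasurableSpace Ω] (P : Measure Ω) [IsProbabilityMeasure P]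
    {γ : ℕ → ℝ} (hγ : Tendsto γ atTop atTop) {X : ℕ → Ω → CC} {k : UI → UI → ℝ}
    (hG : HypG P X γ k) (V : Set CC) (hV : IsOpen V) (x : CC) (hx : x ∈ V) (b : ℝ)
    (hb : (CramerK k x : EReal) < b) :
    LBd γ (fun n => P (X n ⁻¹' V)) b := by
  obtain ⟨H, _, _, _, Φ, hΦ, hk⟩ := exists_feature k hG.2.2.2.1 hG.2.2.2.2.1
  have hfin : CramerK k x ≠ ⊤ := fun h => by
    rw [h] at hb; exact absurd hb (by simp)
  obtain ⟨C, hC⟩ : ∃ C : ℝ≥0, CramerK k x = C := ⟨_, (ENNReal.coe_toNNReal hfin).symm⟩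
  rw [hC, coe_nn, EReal.coe_lt_coe_iff] at hb
  have hbound : ∀ l, pairSM l x - LamK k l ≤ C := by
    intro l
    have h1 : ENNReal.ofReal (pairSM l x - LamK k l) ≤ C := by
      rw [← hC]; exact le_iSup (fun l => ENNReal.ofReal (pairSM l x - LamK k l)) l
    rw [← ENNReal.ofReal_coe_nnreal] at h1
    exact (ENNReal.ofReal_le_ofReal_iff C.2).1 h1
  set T := Finsupp.linearCombination ℝ Φ with hT
  set Lx := Finsupp.linearCombination ℝ (x : UI → ℝ) with hLx
  have hdisc : ∀ c, (Lx c) ^ 2 ≤ 2 * C * ‖T c‖ ^ 2 := by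
    intro c
    have h1 : ∀ r : ℝ, 0 ≤ (‖T c‖ ^ 2 / 2) * (r * r) + (-(Lx c)) * r + C := by
      intro r
      have := hbound (dm (r • c))
      rw [LamK, dblInt_dm k Φ hΦ hk, pairSM_dm _ x.continuous, ← hLx, ← hT, map_smul, map_smul,
        norm_smul, mul_pow, Real.norm_eq_abs, sq_abs, smul_eq_mul] at this
      nlinarith
    have h2 := discrim_le_zero h1
    unfold discrim at h2
    nlinarith
  obtain ⟨g, hg⟩ := T.rangeRestrict.exists_rightInverse_of_surjective T.range_rangeRestrict
  have hTg : ∀ s, T (g s) = s := fun s => by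
    have := LinearMap.congr_fun hg s
    exact congrArg Subtype.val this
  set φ0 : LinearMap.range T →ₗ[ℝ] ℝ := Lx ∘ₗ g with hφ0
  have hφb : ∀ s, ‖φ0 s‖ ≤ √(2 * C) * ‖s‖ := by
    intro s
    have h1 := hdisc (g s)
    rw [hTg] at h1
    have h2 := Real.abs_le_sqrt h1
    rw [Real.sqrt_mul (by positivity), Real.sqrt_sq (norm_nonneg _)] at h2
    exact h2
  obtain ⟨F, hF, hFn⟩ := exists_extension_norm_eq (LinearMap.range T)
    (φ0.mkContinuous (√(2 * C)) hφb)
  have hFn' : ‖F‖ ≤ √(2 * C) := by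
    rw [hFn]; exact LinearMap.mkContinuous_norm_le _ (Real.sqrt_nonneg _) _
  have hFΦ : ∀ t, F (Φ t) = x t := by
    intro t
    have hmem : Φ t ∈ LinearMap.range T := ⟨Finsupp.single t 1, by simp [hT]⟩
    have h1 := hF ⟨Φ t, hmem⟩
    simp only [LinearMap.mkContinuous_apply] at h1
    rw [h1]
    have h2 := hdisc (g ⟨Φ t, hmem⟩ - Finsupp.single t 1)
    have h3 : T (g ⟨Φ t, hmem⟩ - Finsupp.single t 1) = 0 := by
      rw [map_sub, hTg]; simp [hT]
    rw [h3, norm_zero, map_sub] at h2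
    have h4 : Lx (Finsupp.single t 1) = x t := by simp [hLx]
    rw [h4] at h2
    have h5 : φ0 ⟨Φ t, hmem⟩ = Lx (g ⟨Φ t, hmem⟩) := rfl
    rw [h5]
    nlinarith
  set w0 := (InnerProductSpace.toDual ℝ H).symm F with hw0
  have hw0n : ‖w0‖ ≤ √(2 * C) := by rw [hw0, LinearIsometryEquiv.norm_map]; exact hFn'
  set S := (LinearMap.range T).topologicalClosure with hS
  have : CompleteSpace S := (LinearMap.range T).isClosed_topologicalClosure.completeSpace_coe
  set w := S.starProjection w0 with hw
  have hwS : w ∈ S := S.starProjection_apply_mem w0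
  have hΦS : ∀ t, Φ t ∈ S := fun t =>
    (LinearMap.range T).le_topologicalClosure ⟨Finsupp.single t 1, by simp [hT]⟩
  have hwΦ : ∀ t, inner ℝ w (Φ t) = x t := by
    intro t
    rw [hw, Submodule.inner_starProjection_left_eq_right,
      Submodule.starProjection_eq_self_iff.2 (hΦS t), hw0, InnerProductSpace.toDual_symm_apply, hFΦ]
  have hwn : ‖w‖ ≤ √(2 * C) := (S.norm_starProjection_apply_le w0).trans hw0n
  have hwn2 : ‖w‖ ^ 2 / 2 < b := by
    have := pow_le_pow_left₀ (norm_nonneg _) hwn 2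
    rw [Real.sq_sqrt (by positivity)] at this
    linarith
  obtain ⟨ε, hε, hball⟩ := Metric.isOpen_iff.1 hV x hx
  obtain ⟨B, hB⟩ := (isCompact_range hΦ).isBounded.exists_norm_le
  have hB' : ∀ t, ‖Φ t‖ ≤ |B| := fun t => (hB _ ⟨t, rfl⟩).trans (le_abs_self B)
  have hO : IsOpen ({v : H | ‖v‖ ^ 2 / 2 < b} ∩ {v : H | ‖v - w‖ * |B| < ε}) :=
    (isOpen_lt (by fun_prop) continuous_const).inter (isOpen_lt (by fun_prop) continuous_const)
  have hwcl : w ∈ closure (LinearMap.range T : Set H) := by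
    rw [← Submodule.topologicalClosure_coe]; exact hwS
  obtain ⟨w', ⟨hw'1, hw'2⟩, ⟨c, hc⟩⟩ := mem_closure_iff.1 hwcl _ hO ⟨hwn2, by simpa using hε⟩
  have hcont : Continuous fun t => inner ℝ w' (Φ t) := by fun_prop
  refine gauss_lower_discrete P hγ hG Φ hΦ hk c ⟨fun t => inner ℝ w' (Φ t), hcont⟩
    (fun t => by rw [← hT, hc]; rfl) V hV (hball ?_) b (by rw [← hT, hc]; exact hw'1)
  rw [Metric.mem_ball, ContinuousMap.dist_lt_iff hε]
  intro t
  rw [← hwΦ t, Real.dist_eq]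
  show |inner ℝ w' (Φ t) - inner ℝ w (Φ t)| < ε
  rw [← inner_sub_left]
  refine (abs_real_inner_le_norm _ _).trans_lt (lt_of_le_of_lt ?_ hw'2)
  exact mul_le_mul_of_nonneg_left (hB' t) (norm_nonneg _)

lemma coe_lt_real_iff (b : ℝ) (x : ℝ≥0∞) :
    (x : EReal) < (b : EReal) ↔ x < ENNReal.ofReal b := by
  rcases lt_or_ge b 0 with hb | hb
  · rw [ENNReal.ofReal_of_nonpos hb.le]
    simp only [not_lt_zero, iff_false, not_lt]
    exact le_trans (by exact_mod_cast hb.le) (EReal.coe_ennreal_nonneg x)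
  · have : (b : EReal) = ((ENNReal.ofReal b : ℝ≥0∞) : EReal) := by
      rw [EReal.coe_ennreal_ofReal, max_eq_left hb]
    rw [this, EReal.coe_ennreal_lt_coe_ennreal_iff]

lemma contraction_LDP {Ω T : Type*} [MeasurableSpace Ω] (P : Measure Ω) [IsProbabilityMeasure P]
    [TopologicalSpace T] [MeasurableSpace T] [OpensMeasurableSpace T]
    {γ : ℕ → ℝ} (hγ : Tendsto γ atTop atTop)
    (X : ℕ → Ω → CC) (kbar : UI → UI → ℝ) (hG : HypG P X γ kbar)
    (Y : ℕ → Ω → CC × CC) (hYmeas : ∀ n, Measurable (Y n))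
    (hindep : ∀ n, IndepFun (Y n) (X n) P)
    (IY : CC × CC → ℝ≥0∞) (hIYgood : GoodRate IY)
    (hYLDP : LDPrv P Y γ IY)
    (G : (CC × CC) × CC → T) (hGc : Continuous G) (W : ℕ → Ω → T)
    (hWm : ∀ n, Measurable (W n)) (hW : ∀ n ω, W n ω = G (Y n ω, X n ω)) (I : T → ℝ≥0∞)
    (hI1 : ∀ p, I (G p) ≤ IY p.1 + CramerK kbar p.2)
    (hI2 : ∀ q a, I q < a → ∃ p : (CC × CC) × CC, G p = q ∧ IY p.1 + CramerK kbar p.2 < a) :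
    LDPLower (fun n => P.map (W n)) γ I ∧ LDPUpper (fun n => P.map (W n)) γ I := by
  constructor
  · intro Θ hΘ
    refine le_liminf_of_LBd hγ _ _ fun b hb => ?_
    simp only [iInf_lt_iff] at hb
    obtain ⟨q, hq, hqb⟩ := hb
    obtain ⟨p, rfl, hp⟩ := hI2 q _ ((coe_lt_real_iff _ _).1 hqb)
    have := prod_lower (γ := γ) P Y X hindep IY (fun x : CC => CramerK kbar x)
      (fun U hU y hy c hc => by
        have h1 := LBd_of_le_liminf hγ _ _ (hYLDP.2.1 U hU) c ((iInf₂_le y hy).trans_lt hc)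
        refine h1.mono fun n => ?_
        rw [Measure.map_apply (hYmeas n) hU.measurableSet])
      (fun V hV x hx c hc => gauss_lower P hγ hG V hV x hx c hc)
      (G ⁻¹' Θ) (hΘ.preimage hGc) p hq b ((coe_lt_real_iff _ _).2 hp)
    refine this.mono fun n => ?_
    rw [Measure.map_apply (hWm n) hΘ.measurableSet]
    refine measure_mono fun ω hω => ?_
    show W n ω ∈ Θ
    rw [hW]
    exact hω
  · intro Γ hΓ
    refine limsup_le_of_UBd hγ _ _ fun b hb => ?_
    obtain ⟨c, hbc, hc⟩ := EReal.lt_iff_exists_real_btwn.1 hb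
    have := prod_upper P hγ Y X hindep IY (fun x : CC => CramerK kbar x) hIYgood
      (fun C hC d hd d' hd' => by
        have h1 := UBd_of_limsup_le hγ _ _ (hYLDP.2.2 C hC) d'
          ((EReal.coe_lt_coe_iff.2 hd').trans_le (le_iInf₂ fun y hy => (hd y hy).le))
        refine h1.mono fun n => ?_
        rw [Measure.map_apply (hYmeas n) hC.measurableSet])
      (fun x d hd => gauss_local_upper P hγ hG x d hd)
      (fun R hR => by
        obtain ⟨K, hK, hKR⟩ := hG.2.2.1 R hR
        refine ⟨K, hK, fun d hd => UBd_of_limsup_le hγ _ (R : EReal) ?_ d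
          (EReal.coe_lt_coe_iff.2 hd)⟩
        rw [← EReal.coe_neg]
        exact hKR)
      (G ⁻¹' Γ) (hΓ.preimage hGc) c
      (fun p hp => (hc.trans_le (iInf₂_le (G p) hp)).trans_le
        (EReal.coe_ennreal_le_coe_ennreal_iff.2 (hI1 p)))
      b (EReal.coe_lt_coe_iff.1 hbc)
    refine this.mono fun n => ?_
    rw [Measure.map_apply (hWm n) hΓ.measurableSet]
    refine measure_mono fun ω hω => ?_
    show G (Y n ω, X n ω) ∈ Γ
    rw [← hW]
    exact hω

lemma lsc_CramerK (k : UI → UI → ℝ) : LowerSemicontinuous fun x : CC => CramerK k x := by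
  unfold CramerK
  refine lowerSemicontinuous_iSup fun l => Continuous.lowerSemicontinuous ?_
  exact ENNReal.continuous_ofReal.comp ((continuous_pairSM l).sub continuous_const)

/-- The function `r ↦ 1 / max r α`. -/
def invMax (α : ℝ) (hα : 0 < α) : C(ℝ, ℝ) :=
  ⟨fun r => (max r α)⁻¹, (continuous_id.max continuous_const).inv₀
    fun r => (lt_of_lt_of_le hα (le_max_right _ _)).ne'⟩

/-- The quotient `(z - y₂) / y₁`, regularized. -/
def quo (α : ℝ) (hα : 0 < α) (p : (CC × CC) × CC) : CC :=
  (p.2 - p.1.2) * (invMax α hα).comp p.1.1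

lemma continuous_quo (α : ℝ) (hα : 0 < α) : Continuous (quo α hα) := by
  have := (invMax α hα).continuous_postcomp (X := UI)
  unfold quo
  exact (continuous_snd.sub (continuous_snd.comp continuous_fst)).mul
    (this.comp (continuous_fst.comp continuous_fst))

lemma quo_apply (α : ℝ) (hα : 0 < α) (p : (CC × CC) × CC) (hp : p.1.1 ∈ Calpha α) :
    (fun t => (p.2 t - p.1.2 t) / p.1.1 t) = quo α hα p := by
  funext t
  simp [quo, invMax, max_eq_left (hp t), div_eq_mul_inv]

/-- LDP for Gaussian processes with random mean and random variance. -/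
theorem statement0 {Ω : Type*} [MeasurableSpace Ω] (P : Measure Ω) [IsProbabilityMeasure P]
    (α : ℝ) (hα : 0 < α) (γ : ℕ → ℝ) (hγ : Tendsto γ atTop atTop)
    (X : ℕ → Ω → CC) (kbar : UI → UI → ℝ) (hG : HypG P X γ kbar)
    (Y : ℕ → Ω → CC × CC) (hYmeas : ∀ n, Measurable (Y n))
    (hYval : ∀ n ω, (Y n ω).1 ∈ Calpha α)
    (hindep : ∀ n, IndepFun (Y n) (X n) P)
    (IY : CC × CC → ℝ≥0∞) (hIYgood : GoodRate IY)
    (hIYsupp : ∀ p : CC × CC, p.1 ∉ Calpha α → IY p = ⊤)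
    (hYLDP : LDPrv P Y γ IY)
    (Z : ℕ → Ω → CC) (hZ : ∀ n ω, Z n ω = (Y n ω).1 * X n ω + (Y n ω).2) :
    WLDPrv P (fun n ω => (Y n ω, Z n ω)) γ
        (fun p : (CC × CC) × CC =>
          IY p.1 + CramerK kbar fun t => (p.2 t - p.1.2 t) / p.1.1 t) ∧
      LDPrv P Z γ
        (fun z : CC => ⨅ y1 ∈ Calpha α, ⨅ y2 : CC,
          IY (y1, y2) + CramerK kbar fun t => (z t - y2 t) / y1 t) := by
  set I1 : (CC × CC) × CC → ℝ≥0∞ := fun p =>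
    IY p.1 + CramerK kbar fun t => (p.2 t - p.1.2 t) / p.1.1 t with hI1
  have hI1eq : ∀ p, I1 p = IY p.1 + CramerK kbar (quo α hα p) := by
    intro p
    by_cases hp : p.1.1 ∈ Calpha α
    · simp only [hI1, quo_apply α hα p hp]
    · simp only [hI1, hIYsupp p.1 hp, top_add]
  have hlsc1 : LowerSemicontinuous I1 := by
    have e : I1 = fun p => IY p.1 + CramerK kbar (quo α hα p) := funext hI1eq
    rw [e]
    have l1 : LowerSemicontinuous fun p : (CC × CC) × CC => IY p.1 :=
      LowerSemicontinuous.comp hIYgood.1 continuous_fst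
    have l2 : LowerSemicontinuous fun p : (CC × CC) × CC => CramerK kbar (quo α hα p) :=
      LowerSemicontinuous.comp (f := fun x : CC => CramerK kbar x) (lsc_CramerK kbar)
        (continuous_quo α hα)
    exact l1.add l2
  -- evaluation of `I1` on the graph
  have hgraph : ∀ (y : CC × CC) (x : CC), I1 (y, y.1 * x + y.2) = IY y + CramerK kbar x := by
    intro y x
    by_cases hy : y.1 ∈ Calpha α
    · simp only [hI1]
      congr 2
      funext t
      have : y.1 t ≠ 0 := (lt_of_lt_of_le hα (hy t)).ne'
      simp [this]
    · simp only [hI1, hIYsupp y hy, top_add]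
  have hgraph2 : ∀ q : (CC × CC) × CC, q.1.1 ∈ Calpha α →
      q.1.1 * quo α hα q + q.1.2 = q.2 := by
    intro q hq
    ext t
    have h1 := congrFun (quo_apply α hα q hq) t
    have h2 : q.1.1 t ≠ 0 := (lt_of_lt_of_le hα (hq t)).ne'
    simp only [ContinuousMap.add_apply, ContinuousMap.mul_apply, ← h1]
    field_simp
    ring
  have hXm : ∀ n, Measurable (X n) := fun n => (hG.1 n).1
  have hZc : Continuous fun p : (CC × CC) × CC => p.1.1 * p.2 + p.1.2 := by fun_prop
  have hZm : ∀ n, Measurable (Z n) := by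
    intro n
    have e : Z n = (fun p : (CC × CC) × CC => p.1.1 * p.2 + p.1.2) ∘ fun ω => (Y n ω, X n ω) :=
      funext fun ω => hZ n ω
    rw [e]
    exact hZc.measurable.comp ((hYmeas n).prodMk (hXm n))
  constructor
  · obtain ⟨h1, h2⟩ := contraction_LDP P hγ X kbar hG Y hYmeas hindep IY hIYgood hYLDP
      (fun p => (p.1, p.1.1 * p.2 + p.1.2)) (continuous_fst.prodMk hZc)
      (fun n ω => (Y n ω, Z n ω)) (fun n => (hYmeas n).prodMk (hZm n))
      (fun n ω => by rw [hZ]) I1 (fun p => (hgraph p.1 p.2).le)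
      (fun q a hq => by
        by_cases hy : q.1.1 ∈ Calpha α
        · refine ⟨(q.1, quo α hα q), ?_, ?_⟩
          · simp only [hgraph2 q hy]
          · rwa [hI1eq] at hq
        · simp only [hI1, hIYsupp q.1 hy, top_add] at hq
          exact absurd hq not_top_lt)
    exact ⟨hlsc1, h1, fun Γ hΓ => h2 Γ hΓ.isClosed⟩
  · set IZ : CC → ℝ≥0∞ := fun z => ⨅ y1 ∈ Calpha α, ⨅ y2 : CC,
      IY (y1, y2) + CramerK kbar fun t => (z t - y2 t) / y1 t with hIZ
    have hIZle : ∀ y z, IZ z ≤ I1 (y, z) := by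
      intro y z
      by_cases hy : y.1 ∈ Calpha α
      · exact (iInf₂_le y.1 hy).trans (iInf_le _ y.2)
      · simp only [hI1, hIYsupp y hy, top_add, le_top]
    have hIZlt : ∀ z a, IZ z < a → ∃ y : CC × CC, y.1 ∈ Calpha α ∧ I1 (y, z) < a := by
      intro z a h
      simp only [hIZ, iInf_lt_iff] at h
      obtain ⟨y1, h1, y2, h2⟩ := h
      exact ⟨(y1, y2), h1, h2⟩
    have hlsc2 : LowerSemicontinuous IZ := by
      intro z0 b hb
      obtain ⟨c, hbc, hc⟩ := ENNReal.lt_iff_exists_nnreal_btwn.1 hb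
      obtain ⟨u, v, hu, hv, hSu, hzv, huv⟩ := generalized_tube_lemma (hIYgood.2 c)
        (isCompact_singleton (x := z0)) (n := {p | (c : ℝ≥0∞) < I1 p})
        (hlsc1.isOpen_preimage c) (by
          rintro ⟨y, z⟩ ⟨-, hz⟩
          have hz' : z = z0 := hz
          subst hz'
          exact hc.trans_le (hIZle y z))
      filter_upwards [hv.mem_nhds (hzv rfl)] with z hz
      refine hbc.trans_le ?_
      by_contra hcon
      push Not at hcon
      obtain ⟨y, -, hy⟩ := hIZlt z c hcon
      by_cases hyS : IY y ≤ c
      · exact lt_asymm hy (huv (Set.mk_mem_prod (hSu hyS) hz))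
      · have : IY y ≤ I1 (y, z) := le_self_add
        exact hyS (this.trans hy.le)
    obtain ⟨h1, h2⟩ := contraction_LDP P hγ X kbar hG Y hYmeas hindep IY hIYgood hYLDP
      (fun p => p.1.1 * p.2 + p.1.2) hZc Z hZm hZ IZ
      (fun p => (hIZle p.1 _).trans (hgraph p.1 p.2).le)
      (fun z a hz => by
        obtain ⟨y, hy, hya⟩ := hIZlt z a hz
        refine ⟨(y, quo α hα (y, z)), hgraph2 (y, z) hy, ?_⟩
        rwa [hI1eq] at hya)
    exact ⟨hlsc2, h1, h2⟩

end
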